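/- Let A = A_0 ⊕ A_1 with A_0 = span{i}, A_1 = span{j,k}. Equip A with the binary bracket whose nonzero products are [j,k]=6i, [k,j]=6i and the ternary product with nonzero values {i,j,j}=4i, {j,i,j}=-4i, {j,j,i}=-8i, {j,j,k}=-8k, {j,k,j}=4k, {k,j,j}=4k. Then (A,[·,·],{·,·,·}) is a Bol superalgebra. -/

import Mathlib

namespace SuperAlg

/-- The sign `(-1)^{ab}` for degrees `a b : ZMod 2`. -/
def sgn (k : Type*) [Field k] (a b : ZMod 2) : k := (-1 : k) ^ (a.val * b.val)

variable (k A : Type*) [Field k] [AddCommGroup A] [Module k A]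

/-- Iterated composition of a linear self-map. -/
def lpow (f : A →ₗ[k] A) : ℕ → (A →ₗ[k] A)
  | 0 => LinearMap.id
  | (n + 1) => f.comp (lpow f n)

/-- A Bol superalgebra (axioms (SB1)-(SB5)). -/
structure BolSuper where
  grading : ZMod 2 → Submodule k A
  internal : DirectSum.IsInternal grading
  br : A →ₗ[k] A →ₗ[k] A
  tp : A →ₗ[k] A →ₗ[k] A →ₗ[k] A
  br_grade : ∀ (a b : ZMod 2) (x y : A), x ∈ grading a → y ∈ grading b →
    br x y ∈ grading (a + b)
  tp_grade : ∀ (a b c : ZMod 2) (x y z : A), x ∈ grading a → y ∈ grading b → z ∈ grading c →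
    tp x y z ∈ grading (a + b + c)
  sb1 : ∀ (a b : ZMod 2) (x y : A), x ∈ grading a → y ∈ grading b →
    br x y = - sgn k a b • br y x
  sb2 : ∀ (a b : ZMod 2) (x y z : A), x ∈ grading a → y ∈ grading b →
    tp x y z = - sgn k a b • tp y x z
  sb3 : ∀ (a b c : ZMod 2) (x y z : A), x ∈ grading a → y ∈ grading b → z ∈ grading c →
    tp x y z + sgn k a (b + c) • tp y z x + sgn k c (a + b) • tp z x y = 0
  sb4 : ∀ (a b c d : ZMod 2) (x y u v : A), x ∈ grading a → y ∈ grading b →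
      u ∈ grading c → v ∈ grading d →
    tp x y (br u v) = br (tp x y u) v + sgn k c (a + b) • br u (tp x y v)
      + sgn k (a + b) (c + d) • (tp u v (br x y) - br (br u v) (br x y))
  sb5 : ∀ (a b c d : ZMod 2) (x y u v w : A), x ∈ grading a → y ∈ grading b →
      u ∈ grading c → v ∈ grading d →
    tp x y (tp u v w) = tp (tp x y u) v w + sgn k c (a + b) • tp u (tp x y v) w
      + sgn k (a + b) (c + d) • tp u v (tp x y w)

/-- The even part: span of `i`; the odd part: span of `j`, `k`. -/
def grB (k : Type*) [Field k] : ZMod 2 → Submodule k (Fin 3 → k) := fun a =>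
  if a = 0 then Submodule.span k {![1, 0, 0]} else Submodule.span k {![0, 1, 0], ![0, 0, 1]}

/-- `[j,k]=6i`, `[k,j]=6i`. -/
def brFun12 (k : Type*) [Field k] (x y : Fin 3 → k) : Fin 3 → k :=
  ![6 * (x 1 * y 2) + 6 * (x 2 * y 1), 0, 0]

/-- `{i,j,j}=4i`, `{j,i,j}=-4i`, `{j,j,i}=-8i`, `{j,j,k}=-8k`, `{j,k,j}=4k`, `{k,j,j}=4k`. -/
def tpFun12 (k : Type*) [Field k] (x y z : Fin 3 → k) : Fin 3 → k :=
  ![4 * (x 0 * y 1 * z 1) - 4 * (x 1 * y 0 * z 1) - 8 * (x 1 * y 1 * z 0), 0,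
    -8 * (x 1 * y 1 * z 2) + 4 * (x 1 * y 2 * z 1) + 4 * (x 2 * y 1 * z 1)]

theorem forall_zmod_two {p : ZMod 2 → Prop} (h₀ : p 0) (h₁ : p 1) : ∀ a, p a := by
  intro a
  fin_cases a
  exacts [h₀, h₁]

theorem funext_fin_three {k : Type*} {x y : Fin 3 → k} (h₀ : x 0 = y 0) (h₁ : x 1 = y 1)
    (h₂ : x 2 = y 2) : x = y := by
  ext i
  fin_cases i
  exacts [h₀, h₁, h₂]

theorem mem_grB_zero {k : Type*} [Field k] {x : Fin 3 → k} :
    x ∈ grB k 0 ↔ x 1 = 0 ∧ x 2 = 0 := by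
  rw [grB, if_pos rfl, Submodule.mem_span_singleton]
  constructor
  · rintro ⟨c, rfl⟩
    simp
  · rintro ⟨h₁, h₂⟩
    refine ⟨x 0, ?_⟩
    ext i
    fin_cases i <;> simp [h₁, h₂]

theorem mem_grB_one {k : Type*} [Field k] {x : Fin 3 → k} :
    x ∈ grB k 1 ↔ x 0 = 0 := by
  rw [grB, if_neg one_ne_zero, Submodule.mem_span_pair]
  constructor
  · rintro ⟨c, d, rfl⟩
    simp
  · intro h
    refine ⟨x 1, x 2, ?_⟩
    ext i
    fin_cases i <;> simp [h]

theorem isInternal_grB (k : Type*) [Field k] : DirectSum.IsInternal (grB k) := by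
  have h_univ : (Set.univ : Set (ZMod 2)) = {0, 1} := by
    refine Set.ext (forall_zmod_two ?_ ?_) <;> simp
  rw [DirectSum.isInternal_submodule_iff_isCompl (grB k) zero_ne_one h_univ]
  constructor
  · rw [Submodule.disjoint_def]
    intro x h₀ h₁
    rw [mem_grB_zero] at h₀
    rw [mem_grB_one] at h₁
    ext i
    fin_cases i <;> simp [h₀, h₁]
  · rw [codisjoint_iff, Submodule.eq_top_iff']
    intro x
    refine Submodule.mem_sup.2 ⟨![x 0, 0, 0], mem_grB_zero.2 (by simp),
      ![0, x 1, x 2], mem_grB_one.2 (by simp), ?_⟩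
    ext i
    fin_cases i <;> simp

/-- The bracket `brFun12` as a bilinear map. -/
def brLinear (k : Type*) [Field k] : (Fin 3 → k) →ₗ[k] (Fin 3 → k) →ₗ[k] (Fin 3 → k) :=
  LinearMap.mk₂ k (brFun12 k)
    (by intros; ext i; fin_cases i <;> simp [brFun12]; ring)
    (by intros; ext i; fin_cases i <;> simp [brFun12]; ring)
    (by intros; ext i; fin_cases i <;> simp [brFun12]; ring)
    (by intros; ext i; fin_cases i <;> simp [brFun12]; ring)

/-- The ternary product `tpFun12` as a trilinear map. -/
def tpLinear (k : Type*) [Field k] :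
    (Fin 3 → k) →ₗ[k] (Fin 3 → k) →ₗ[k] (Fin 3 → k) →ₗ[k] (Fin 3 → k) :=
  LinearMap.mk₂ k
    (fun x y =>
      { toFun := tpFun12 k x y
        map_add' := by intros; ext i; fin_cases i <;> simp [tpFun12] <;> ring
        map_smul' := by intros; ext i; fin_cases i <;> simp [tpFun12] <;> ring })
    (by intros; ext z i; fin_cases i <;> simp [tpFun12] <;> ring)
    (by intros; ext z i; fin_cases i <;> simp [tpFun12] <;> ring)
    (by intros; ext z i; fin_cases i <;> simp [tpFun12] <;> ring)
    (by intros; ext z i; fin_cases i <;> simp [tpFun12] <;> ring)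

theorem brLinear_apply {k : Type*} [Field k] (x y : Fin 3 → k) :
    brLinear k x y = brFun12 k x y := rfl

theorem tpLinear_apply {k : Type*} [Field k] (x y z : Fin 3 → k) :
    tpLinear k x y z = tpFun12 k x y z := rfl

theorem sgn_zero_left (k : Type*) [Field k] (b : ZMod 2) : sgn k 0 b = 1 := by
  simp [sgn]

theorem sgn_zero_right (k : Type*) [Field k] (a : ZMod 2) : sgn k a 0 = 1 := by
  simp [sgn]

theorem sgn_one_one (k : Type*) [Field k] : sgn k 1 1 = -1 := by
  simp [sgn, ZMod.val_one]

theorem one_add_one_zmod_two : (1 + 1 : ZMod 2) = 0 := rfl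

theorem brFun12_zero {k : Type*} [Field k] (x y : Fin 3 → k) :
    brFun12 k x y 0 = 6 * (x 1 * y 2) + 6 * (x 2 * y 1) := rfl

theorem brFun12_one {k : Type*} [Field k] (x y : Fin 3 → k) : brFun12 k x y 1 = 0 := rfl

theorem brFun12_two {k : Type*} [Field k] (x y : Fin 3 → k) : brFun12 k x y 2 = 0 := rfl

theorem tpFun12_zero {k : Type*} [Field k] (x y z : Fin 3 → k) :
    tpFun12 k x y z 0 =
      4 * (x 0 * y 1 * z 1) - 4 * (x 1 * y 0 * z 1) - 8 * (x 1 * y 1 * z 0) := rfl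

theorem tpFun12_one {k : Type*} [Field k] (x y z : Fin 3 → k) : tpFun12 k x y z 1 = 0 := rfl

theorem tpFun12_two {k : Type*} [Field k] (x y z : Fin 3 → k) :
    tpFun12 k x y z 2 =
      -8 * (x 1 * y 1 * z 2) + 4 * (x 1 * y 2 * z 1) + 4 * (x 2 * y 1 * z 1) := rfl

/-- The Bol superalgebra on `k³` with bracket `brFun12` and ternary product `tpFun12`. -/
def bolSuper12 (k : Type*) [Field k] : BolSuper k (Fin 3 → k) where
  grading := grB k
  internal := isInternal_grB k
  br := brLinear k
  tp := tpLinear k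
  br_grade := by
    refine forall_zmod_two ?_ ?_ <;> refine forall_zmod_two ?_ ?_ <;>
    intro x y hx hy <;>
    simp only [add_zero, zero_add, one_add_one_zmod_two, mem_grB_zero, mem_grB_one] at hx hy ⊢ <;>
    simp [brLinear_apply, brFun12_zero, brFun12_one, brFun12_two, hx, hy]
  tp_grade := by
    refine forall_zmod_two ?_ ?_ <;> refine forall_zmod_two ?_ ?_ <;> refine forall_zmod_two ?_ ?_ <;>
    intro x y z hx hy hz <;>
    simp only [add_zero, zero_add, one_add_one_zmod_two, mem_grB_zero, mem_grB_one] at hx hy hz ⊢ <;>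
    simp [tpLinear_apply, tpFun12_zero, tpFun12_one, tpFun12_two, hx, hy, hz]
  sb1 := by
    refine forall_zmod_two ?_ ?_ <;> refine forall_zmod_two ?_ ?_ <;>
    intro x y hx hy <;>
    simp only [mem_grB_zero, mem_grB_one] at hx hy <;>
    apply funext_fin_three <;>
    simp only [sgn_zero_left, sgn_zero_right, sgn_one_one, brLinear_apply, brFun12_zero,
      brFun12_one, brFun12_two, Pi.smul_apply, smul_eq_mul, hx, hy] <;>
    ring
  sb2 := by
    refine forall_zmod_two ?_ ?_ <;> refine forall_zmod_two ?_ ?_ <;>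
    intro x y z hx hy <;>
    simp only [mem_grB_zero, mem_grB_one] at hx hy <;>
    apply funext_fin_three <;>
    simp only [sgn_zero_left, sgn_zero_right, sgn_one_one, tpLinear_apply, tpFun12_zero,
      tpFun12_one, tpFun12_two, Pi.smul_apply, smul_eq_mul, hx, hy] <;>
    ring
  sb3 := by
    refine forall_zmod_two ?_ ?_ <;> refine forall_zmod_two ?_ ?_ <;> refine forall_zmod_two ?_ ?_ <;>
    intro x y z hx hy hz <;>
    simp only [mem_grB_zero, mem_grB_one] at hx hy hz <;>
    apply funext_fin_three <;>
    simp only [add_zero, zero_add, one_add_one_zmod_two, sgn_zero_left, sgn_zero_right,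
      sgn_one_one, tpLinear_apply, tpFun12_zero, tpFun12_one, tpFun12_two, Pi.add_apply,
      Pi.smul_apply, Pi.zero_apply, smul_eq_mul, hx, hy, hz] <;>
    ring
  sb4 := by
    refine forall_zmod_two ?_ ?_ <;> refine forall_zmod_two ?_ ?_ <;> refine forall_zmod_two ?_ ?_ <;>
    refine forall_zmod_two ?_ ?_ <;>
    intro x y u v hx hy hu hv <;>
    simp only [mem_grB_zero, mem_grB_one] at hx hy hu hv <;>
    apply funext_fin_three <;>
    simp only [add_zero, zero_add, one_add_one_zmod_two, sgn_zero_left, sgn_zero_right,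
      sgn_one_one, brLinear_apply, brFun12_zero, brFun12_one, brFun12_two, tpLinear_apply,
      tpFun12_zero, tpFun12_one, tpFun12_two, Pi.add_apply, Pi.sub_apply, Pi.smul_apply,
      smul_eq_mul, hx, hy, hu, hv] <;>
    ring
  sb5 := by
    refine forall_zmod_two ?_ ?_ <;> refine forall_zmod_two ?_ ?_ <;> refine forall_zmod_two ?_ ?_ <;>
    refine forall_zmod_two ?_ ?_ <;>
    intro x y u v w hx hy hu hv <;>
    simp only [mem_grB_zero, mem_grB_one] at hx hy hu hv <;>
    apply funext_fin_three <;>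
    simp only [add_zero, zero_add, one_add_one_zmod_two, sgn_zero_left, sgn_zero_right,
      sgn_one_one, tpLinear_apply, tpFun12_zero, tpFun12_one, tpFun12_two, Pi.add_apply,
      Pi.smul_apply, smul_eq_mul, hx, hy, hu, hv] <;>
    ring

/-- Example 4.1 (second part): the given binary and ternary products define a
Bol superalgebra. -/
theorem example41_bolSuper (hk2 : (2 : k) ≠ 0) (hk3 : (3 : k) ≠ 0) :
    ∃ B : BolSuper k (Fin 3 → k), B.grading = grB k ∧
      (∀ x y, B.br x y = brFun12 k x y) ∧ (∀ x y z, B.tp x y z = tpFun12 k x y z) := by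
  exact ⟨bolSuper12 k, rfl, fun _ _ => rfl, fun _ _ _ => rfl⟩

end SuperAlg
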